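/- Let 𝔽_{p^m} be a finite field and let a ∈ 𝔽_{p^m}^ℕ be a b,c-eventually periodic sequence. Then there exists k ∈ ℕ such that the set of vectors {a_{[i,i+k)}}_{i=0}^{b−1} ⊂ 𝔽_{p^m}^k is linearly independent. -/

import Mathlib

/-- The left shift on one-sided sequences over the alphabet `A`. -/
def shiftN (A : Type) : (ℕ → A) → (ℕ → A) := fun a k => a (k + 1)

/-- The word `a_{[i,i+k)} = (a_i, a_{i+1}, …, a_{i+k-1})` of length `k` starting at `i`,
viewed as a vector in `A^k`. -/
def word {A : Type} (a : ℕ → A) (i k : ℕ) : Fin k → A := fun t => a (i + t.1)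

/-- `a` is a periodic sequence (some positive period). -/
def IsPeriodicSeq {A : Type} (a : ℕ → A) : Prop := ∃ c, 0 < c ∧ ∀ n, a (n + c) = a n

/-- `a` is `c`-periodic: `c` is the minimal positive integer with `a_n = a_{n+c}` for all `n`. -/
def IsPeriodicC {A : Type} (a : ℕ → A) (c : ℕ) : Prop :=
  (0 < c ∧ ∀ n, a (n + c) = a n) ∧ ∀ c', 0 < c' → (∀ n, a (n + c') = a n) → c ≤ c'

/-- `a` is `b,c`-eventually periodic: `σ^b(a)` is `c`-periodic but `σ^{b-1}(a)` is not
periodic. -/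
def IsEvPeriodicBC {A : Type} (a : ℕ → A) (b c : ℕ) : Prop :=
  IsPeriodicC ((shiftN A)^[b] a) c ∧ (0 < b → ¬ IsPeriodicSeq ((shiftN A)^[b - 1] a))

theorem shiftN_iterate_apply {A : Type} (a : ℕ → A) (j n : ℕ) :
    (shiftN A)^[j] a n = a (n + j) := by
  induction j generalizing a with
  | zero => rfl
  | succ j ih => rw [Function.iterate_succ_apply, ih]; rfl

/-- A Hankel matrix `d (i + t)` supported on `i + t < b` with nonzero antidiagonal has trivial
left kernel. -/
theorem hankel_antitriangular_injective {F : Type} [Field F] {b : ℕ} {d : ℕ → F}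
    (hzero : ∀ n, b ≤ n → d n = 0) (hne : 0 < b → d (b - 1) ≠ 0) (g : Fin b → F)
    (hg : ∀ t < b, ∑ i : Fin b, g i * d (i + t) = 0) (i : Fin b) : g i = 0 := by
  obtain ⟨j, hj⟩ := i
  induction j using Nat.strong_induction_on with
  | _ j ih =>
    have hsum := hg (b - 1 - j) (by omega)
    rw [Finset.sum_eq_single ⟨j, hj⟩ ?_ (by simp)] at hsum
    · rw [show j + (b - 1 - j) = b - 1 by omega] at hsum
      exact (mul_eq_zero.mp hsum).resolve_right (hne (by omega))
    · rintro ⟨i, hi⟩ - hij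
      have hij' : i ≠ j := fun e => hij (Fin.ext e)
      rcases lt_or_gt_of_ne hij' with hlt | hgt
      · rw [ih i hlt hi, zero_mul]
      · rw [hzero _ (show b ≤ i + (b - 1 - j) by omega), mul_zero]

/-- If `a` is a `b,c`-eventually periodic sequence over a finite field
`F`, then there exists `k` such that the vectors `a_{[i,i+k)}`, `i = 0, …, b−1`, are
linearly independent in `F^k`. -/
theorem evPeriodic_words_linearIndependent (F : Type) [Field F] [Fintype F]
    (a : ℕ → F) (b c : ℕ) (h : IsEvPeriodicBC a b c) :
    ∃ k, LinearIndependent F (fun i : Fin b => word a i.1 k) := by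
  obtain ⟨⟨⟨hc, hper⟩, -⟩, hnot⟩ := h
  simp only [shiftN_iterate_apply] at hper
  have hzero : ∀ n, b ≤ n → a (n + c) - a n = 0 := by
    intro n hn
    have hn' := hper (n - b)
    rw [show n - b + c + b = n + c by omega, Nat.sub_add_cancel hn] at hn'
    exact sub_eq_zero.mpr hn'
  have hne : 0 < b → a (b - 1 + c) - a (b - 1) ≠ 0 := by
    intro hb heq
    refine hnot hb ⟨c, hc, fun n => ?_⟩
    simp only [shiftN_iterate_apply]
    rcases Nat.eq_zero_or_pos n with rfl | hn
    · simpa [add_comm] using sub_eq_zero.mp heq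
    · rw [add_right_comm]
      exact sub_eq_zero.mp (hzero (n + (b - 1)) (by omega))
  refine ⟨b + c, Fintype.linearIndependent_iff.mpr fun g hg =>
    hankel_antitriangular_injective (d := fun n => a (n + c) - a n) hzero hne g fun t ht => ?_⟩
  have hrel : ∀ s < b + c, ∑ i : Fin b, g i * a (i + s) = 0 := fun s hs => by
    simpa [word] using congrFun hg ⟨s, hs⟩
  simp only [mul_sub, Finset.sum_sub_distrib, add_assoc]
  rw [hrel (t + c) (by omega), hrel t (by omega), sub_zero]
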